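/- Let α ≥ 1, γ > 0, and β > 0 be real with the Gamma function nondecreasing on [β, ∞) (which holds exactly when β ≥ t₀, t₀ being the unique positive minimum point of Γ). Define the Turánian difference Δ_T(t) = [E_{α,α+β}^{γ+1}(t^α)]² − E_{α,β}^γ(t^α) · E_{α,2α+β}^{γ+2}(t^α). Then for all t > 0, Δ_T(t) ≤ ( ₁F₁(γ; β; t^α) / (γ Γ(β) t^α) ) · [ ₁F₁(γ+1; α+β; t^α)/Γ(α+β) + t^α ₁F₁(γ+2; 2α+β; t^α)/Γ(2α+β) ]. -/

import Mathlib

open scoped BigOperators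

/-- Pochhammer symbol `(γ)_k = Γ(γ+k)/Γ(γ)`. -/
noncomputable def poch (γ : ℝ) (k : ℕ) : ℝ := Real.Gamma (γ + k) / Real.Gamma γ

/-- The Prabhakar (three-parameter Mittag-Leffler) function
`E_{α,β}^γ(x) = ∑_{k≥0} (γ)_k x^k / (k! Γ(αk+β))`. -/
noncomputable def prabhakar (α β γ x : ℝ) : ℝ :=
  ∑' k : ℕ, poch γ k * x ^ k / (k.factorial * Real.Gamma (α * k + β))

/-- Kummer's confluent hypergeometric function `₁F₁(a;b;z) = ∑_{k≥0} ((a)_k/(b)_k) z^k/k!`. -/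
noncomputable def kummer (a b z : ℝ) : ℝ :=
  ∑' k : ℕ, (poch a k / poch b k) * z ^ k / k.factorial

lemma poch_pos {a : ℝ} (ha : 0 < a) (k : ℕ) : 0 < poch a k :=
  div_pos (Real.Gamma_pos_of_pos (by positivity)) (Real.Gamma_pos_of_pos ha)

lemma poch_succ {a : ℝ} (ha : 0 < a) (k : ℕ) : poch a (k + 1) = (a + k) * poch a k := by
  have h : a + k ≠ 0 := by positivity
  unfold poch
  rw [Nat.cast_succ, ← add_assoc, Real.Gamma_add_one h, mul_div_assoc]

lemma poch_succ_left {a : ℝ} (ha : 0 < a) (k : ℕ) : poch a (k + 1) = a * poch (a + 1) k := by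
  have h := (Real.Gamma_pos_of_pos ha).ne'
  unfold poch
  rw [Real.Gamma_add_one ha.ne', Nat.cast_succ, show a + (k + 1 : ℝ) = a + 1 + k by ring]
  field_simp

lemma summable_kummer {a b z : ℝ} (ha : 0 < a) (hb : 0 < b) (hz : 0 < z) :
    Summable fun k : ℕ => (poch a k / poch b k) * z ^ k / k.factorial := by
  have hpos (k : ℕ) : 0 < (poch a k / poch b k) * z ^ k / k.factorial := by
    have := poch_pos ha k
    have := poch_pos hb k
    positivity
  refine summable_of_ratio_test_tendsto_lt_one (l := 0) one_pos
    (.of_forall fun k => (hpos k).ne') ?_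
  have hratio (k : ℕ) : ‖(poch a (k + 1) / poch b (k + 1)) * z ^ (k + 1) / (k + 1).factorial‖ /
      ‖(poch a k / poch b k) * z ^ k / k.factorial‖ = (a + k) / (b + k) * (z / (k + 1)) := by
    rw [Real.norm_of_nonneg (hpos _).le, Real.norm_of_nonneg (hpos _).le, poch_succ ha,
      poch_succ hb, Nat.factorial_succ]
    have := poch_pos ha k
    have := poch_pos hb k
    push_cast
    field_simp
    ring
  simp_rw [hratio]
  have h₁ : Filter.Tendsto (fun k : ℕ => (a + k) / (b + k)) Filter.atTop (nhds 1) := by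
    simpa using tendsto_add_mul_div_add_mul_atTop_nhds a b (1 : ℝ) one_ne_zero
  have h₂ : Filter.Tendsto (fun k : ℕ => z / ((k : ℝ) + 1)) Filter.atTop (nhds 0) :=
    (tendsto_natCast_atTop_atTop.atTop_add tendsto_const_nhds).const_div_atTop z
  simpa using h₁.mul h₂

section Comparison

variable {α β γ x : ℝ} (hα : 1 ≤ α) (hβ : 0 < β) (hγ : 0 < γ) (hx : 0 < x)

include hα hβ hγ hx

lemma prabhakar_term_nonneg (k : ℕ) :
    0 ≤ poch γ k * x ^ k / (k.factorial * Real.Gamma (α * k + β)) := by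
  have := poch_pos hγ k
  have := Real.Gamma_pos_of_pos (show 0 < α * k + β by positivity)
  positivity

lemma prabhakar_term_le (hmono : MonotoneOn Real.Gamma (Set.Ici β)) (k : ℕ) :
    poch γ k * x ^ k / (k.factorial * Real.Gamma (α * k + β)) ≤
      (poch γ k / poch β k) * x ^ k / k.factorial / Real.Gamma β := by
  have hp := poch_pos hγ k
  have hk : (0 : ℝ) ≤ k := k.cast_nonneg
  have hΓ := Real.Gamma_pos_of_pos hβ
  have hΓk := Real.Gamma_pos_of_pos (show 0 < β + k by positivity)
  have hle : Real.Gamma (β + k) ≤ Real.Gamma (α * k + β) :=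
    hmono (by simp) (by simpa using by positivity) (by nlinarith)
  calc _ ≤ poch γ k * x ^ k / (k.factorial * Real.Gamma (β + k)) := by gcongr
    _ = _ := by
      rw [show poch β k = Real.Gamma (β + k) / Real.Gamma β from rfl]
      field_simp

lemma summable_prabhakar (hmono : MonotoneOn Real.Gamma (Set.Ici β)) :
    Summable fun k : ℕ => poch γ k * x ^ k / (k.factorial * Real.Gamma (α * k + β)) :=
  .of_nonneg_of_le (prabhakar_term_nonneg hα hβ hγ hx) (prabhakar_term_le hα hβ hγ hx hmono)
    ((summable_kummer hγ hβ hx).div_const _)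

lemma prabhakar_nonneg : 0 ≤ prabhakar α β γ x :=
  tsum_nonneg (prabhakar_term_nonneg hα hβ hγ hx)

lemma prabhakar_le_kummer (hmono : MonotoneOn Real.Gamma (Set.Ici β)) :
    prabhakar α β γ x ≤ kummer γ β x / Real.Gamma β := by
  rw [kummer, ← tsum_div_const]
  exact (summable_prabhakar hα hβ hγ hx hmono).tsum_le_tsum
    (prabhakar_term_le hα hβ hγ hx hmono) ((summable_kummer hγ hβ hx).div_const _)

omit hα hβ hx in
lemma succ_mul_prabhakar_term_succ (k : ℕ) :
    ((k + 1 : ℕ) : ℝ) *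
        (poch γ (k + 1) * x ^ (k + 1) /
          ((k + 1).factorial * Real.Gamma (α * (k + 1 : ℕ) + β))) =
      γ * x * (poch (γ + 1) k * x ^ k / (k.factorial * Real.Gamma (α * k + (α + β)))) := by
  rw [poch_succ_left hγ, Nat.factorial_succ, Nat.cast_mul,
    show α * ((k + 1 : ℕ) : ℝ) + β = α * k + (α + β) by push_cast; ring, ← mul_div_assoc,
    mul_assoc (Nat.cast _ : ℝ), mul_div_mul_left _ _ (by positivity)]
  ring

lemma hasSum_mul_prabhakar_term (hmono : MonotoneOn Real.Gamma (Set.Ici (α + β))) :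
    HasSum (fun k : ℕ => k * (poch γ k * x ^ k / (k.factorial * Real.Gamma (α * k + β))))
      (γ * x * prabhakar α (α + β) (γ + 1) x) := by
  rw [← hasSum_nat_add_iff' 1]
  simp_rw [succ_mul_prabhakar_term_succ hγ]
  simpa [prabhakar] using
    (summable_prabhakar hα (by positivity) (by positivity) hx hmono).hasSum.mul_left (γ * x)

lemma hasSum_sq_mul_prabhakar_term (hmono : MonotoneOn Real.Gamma (Set.Ici (α + β))) :
    HasSum (fun k : ℕ => (k : ℝ) ^ 2 *
        (poch γ k * x ^ k / (k.factorial * Real.Gamma (α * k + β))))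
      (γ * x * (prabhakar α (α + β) (γ + 1) x +
        (γ + 1) * x * prabhakar α (2 * α + β) (γ + 2) x)) := by
  have hmono' : MonotoneOn Real.Gamma (Set.Ici (α + (α + β))) :=
    hmono.mono (Set.Ici_subset_Ici.2 (by linarith))
  have h := ((summable_prabhakar (γ := γ + 1) hα (by positivity) (by positivity) hx
    hmono).hasSum.add (hasSum_mul_prabhakar_term (γ := γ + 1) hα (by positivity) (by positivity)
    hx hmono')).mul_left (γ * x)
  rw [← prabhakar, show α + (α + β) = 2 * α + β by ring, show γ + 1 + 1 = γ + 2 by ring] at h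
  rw [← hasSum_nat_add_iff' 1]
  simp_rw [pow_two (Nat.cast _ : ℝ), mul_assoc (Nat.cast _ : ℝ), succ_mul_prabhakar_term_succ hγ]
  simp only [Finset.range_one, Finset.sum_singleton, Nat.cast_zero, zero_mul, sub_zero]
  refine h.congr_fun fun k => ?_
  push_cast
  ring

end Comparison

/-- The Cauchy–Schwarz inequality for the first two moments of a nonnegative sequence. -/
lemma sq_le_mul_of_hasSum_moments {a : ℕ → ℝ} {s₀ s₁ s₂ : ℝ} (ha : ∀ k, 0 ≤ a k)
    (h₀ : HasSum a s₀) (h₁ : HasSum (fun k : ℕ => k * a k) s₁)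
    (h₂ : HasSum (fun k : ℕ => (k : ℝ) ^ 2 * a k) s₂) : s₁ ^ 2 ≤ s₀ * s₂ := by
  have h (c : ℝ) : 0 ≤ s₀ * (c * c) + (-2 * s₁) * c + s₂ := by
    have hs := ((h₀.mul_right (c * c)).add ((h₁.mul_left (-2)).mul_right c)).add h₂
    refine hs.nonneg fun k => ?_
    have := mul_nonneg (sq_nonneg ((k : ℝ) - c)) (ha k)
    linarith
  have := discrim_le_zero h
  unfold discrim at this
  linarith

/-- Kummer-type functional upper bound for the Turánian difference:
`Δ_T(t) ≤ (₁F₁(γ;β;t^α)/(γ Γ(β) t^α)) [₁F₁(γ+1;α+β;t^α)/Γ(α+β)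
          + t^α ₁F₁(γ+2;2α+β;t^α)/Γ(2α+β)]`. -/
theorem turanian_difference_kummer_bound (α β γ : ℝ) (hα : 1 ≤ α) (hβ : 0 < β) (hγ : 0 < γ)
    (hmono : MonotoneOn Real.Gamma (Set.Ici β)) (t : ℝ) (ht : 0 < t) :
    (prabhakar α (α + β) (γ + 1) (t ^ α)) ^ 2
        - prabhakar α β γ (t ^ α) * prabhakar α (2 * α + β) (γ + 2) (t ^ α)
      ≤ kummer γ β (t ^ α) / (γ * Real.Gamma β * t ^ α)
          * (kummer (γ + 1) (α + β) (t ^ α) / Real.Gamma (α + β)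
              + t ^ α * kummer (γ + 2) (2 * α + β) (t ^ α) / Real.Gamma (2 * α + β)) := by
  have hα₀ : 0 < α := by positivity
  have hx : 0 < t ^ α := Real.rpow_pos_of_pos ht α
  generalize t ^ α = x at hx ⊢
  have hmono₁ : MonotoneOn Real.Gamma (Set.Ici (α + β)) :=
    hmono.mono (Set.Ici_subset_Ici.2 (by linarith))
  have hmono₂ : MonotoneOn Real.Gamma (Set.Ici (2 * α + β)) :=
    hmono.mono (Set.Ici_subset_Ici.2 (by linarith))
  have hβ₁ : 0 < α + β := by positivity
  have hβ₂ : 0 < 2 * α + β := by positivity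
  have hγ₁ : 0 < γ + 1 := by positivity
  have hγ₂ : 0 < γ + 2 := by positivity
  have hcs := sq_le_mul_of_hasSum_moments (prabhakar_term_nonneg hα hβ hγ hx)
    (summable_prabhakar hα hβ hγ hx hmono).hasSum
    (hasSum_mul_prabhakar_term hα hβ hγ hx hmono₁)
    (hasSum_sq_mul_prabhakar_term hα hβ hγ hx hmono₁)
  have hA := prabhakar_le_kummer hα hβ hγ hx hmono
  have hB := prabhakar_le_kummer hα hβ₁ hγ₁ hx hmono₁
  have hC := prabhakar_le_kummer hα hβ₂ hγ₂ hx hmono₂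
  have hA₀ := prabhakar_nonneg hα hβ hγ hx
  have hB₀ := prabhakar_nonneg hα hβ₁ hγ₁ hx
  have hC₀ := prabhakar_nonneg hα hβ₂ hγ₂ hx
  rw [← prabhakar] at hcs
  calc _ ≤ prabhakar α β γ x / (γ * x) *
        (prabhakar α (α + β) (γ + 1) x + x * prabhakar α (2 * α + β) (γ + 2) x) := by
        rw [div_mul_eq_mul_div, le_div_iff₀ (by positivity)]
        refine le_of_mul_le_mul_left ?_ (mul_pos hγ hx)
        linarith
    _ ≤ kummer γ β x / Real.Gamma β / (γ * x) *
        (kummer (γ + 1) (α + β) x / Real.Gamma (α + β) +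
          x * (kummer (γ + 2) (2 * α + β) x / Real.Gamma (2 * α + β))) := by
        have := hA₀.trans hA
        gcongr
    _ = _ := by
        rw [div_div, mul_div_assoc x, ← mul_assoc (Real.Gamma β), mul_comm (Real.Gamma β) γ]
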